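/- There exists a constant C > 0 such that for every real α ≥ 1 and every integer n with n ≥ C·√α, there exist a finite connected simple graph G on n vertices, a Nash equilibrium S of the MAX-game on G, and a nonempty profile S* with c(S) ≥ (n/(C·√α))·c(S*); i.e., the price of anarchy of the MAX-game is Ω(1 + n/√α) for α ≥ 1. -/

import Mathlib

open Finset

/-- Distance from a node `u` to the gateway set `S` (hop distance to nearest gateway). -/
noncomputable def gwDist {V : Type*} (G : SimpleGraph V) (S : Finset V) (u : V) : ℕ :=
  sInf ((fun s => G.dist u s) '' (S : Set V))

/-- Communication distance `δ_S(u,v) = min{d(u,v), d(u,S) + d(S,v)}`. -/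
noncomputable def comDist {V : Type*} (G : SimpleGraph V) (S : Finset V) (u v : V) : ℕ :=
  min (G.dist u v) (gwDist G S u + gwDist G S v)

/-- Private cost of node `v` in the MAX-game. -/
noncomputable def maxCost {V : Type*} [Fintype V] [DecidableEq V]
    (G : SimpleGraph V) (α : ℝ) (S : Finset V) (v : V) : ℝ :=
  (if v ∈ S then α else 0) + ((Finset.univ.sup (fun u => comDist G S v u) : ℕ) : ℝ)

/-- Social cost of the MAX-game. -/
noncomputable def maxSocial {V : Type*} [Fintype V] [DecidableEq V]
    (G : SimpleGraph V) (α : ℝ) (S : Finset V) : ℝ :=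
  ∑ v : V, maxCost G α S v

/-- `v` performs an improving response changing profile `S` into `S'` in the MAX-game. -/
def MaxIRBy {V : Type*} [Fintype V] [DecidableEq V]
    (G : SimpleGraph V) (α : ℝ) (v : V) (S S' : Finset V) : Prop :=
  ((v ∉ S ∧ S' = insert v S) ∨ (v ∈ S ∧ S' = S.erase v ∧ (S.erase v).Nonempty)) ∧
    maxCost G α S' v < maxCost G α S v

/-- `S'` arises from `S` by an improving response in the MAX-game. -/
def MaxIR {V : Type*} [Fintype V] [DecidableEq V]
    (G : SimpleGraph V) (α : ℝ) (S S' : Finset V) : Prop :=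
  ∃ v, MaxIRBy G α v S S'

/-- `S` is a Nash equilibrium of the MAX-game: no node has an improving response. -/
def MaxNash {V : Type*} [Fintype V] [DecidableEq V]
    (G : SimpleGraph V) (α : ℝ) (S : Finset V) : Prop :=
  ∀ S', ¬ MaxIR G α S S'

/-- Parent of the vertex `i` in a spider with three legs of length `m`, the vertices beyond `3 * m`
being pendant at the centre `0`. -/
def spiderParent (m i : ℕ) : ℕ := if i ≤ 3 * m then i - 3 else 0

/-- Distance of the vertex `i` of the spider from the centre `0`. -/
def spiderDepth (m i : ℕ) : ℕ := if i ≤ 3 * m then (i + 2) / 3 else 1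

/-- Signed depth: positive on the leg of residue `r` modulo three, nonpositive elsewhere. -/
def spiderHeight (m r i : ℕ) : ℤ :=
  if i ≤ 3 * m ∧ i % 3 = r then spiderDepth m i else -spiderDepth m i

/-- The spider on `n` vertices with three legs of length `m`. -/
def spider (n m : ℕ) : SimpleGraph (Fin n) :=
  SimpleGraph.fromRel fun i j => (j : ℕ) = spiderParent m i

/-- A potential that changes by at most one along edges bounds the distance from below. -/
theorem SimpleGraph.Connected.sub_le_dist {V : Type*} {G : SimpleGraph V} (hG : G.Connected)
    (f : V → ℤ) (hf : ∀ x y, G.Adj x y → f y - f x ≤ 1) (x y : V) :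
    f y - f x ≤ G.dist x y := by
  obtain ⟨p, hp⟩ := hG.exists_walk_length_eq_dist x y
  rw [← hp]
  clear hp
  induction p with
  | nil => simp
  | cons h p ih =>
    have := hf _ _ h
    simp only [SimpleGraph.Walk.length_cons]
    push_cast
    linarith

theorem gwDist_le {V : Type*} (G : SimpleGraph V) {S : Finset V} (u : V) {s : V} (hs : s ∈ S) :
    gwDist G S u ≤ G.dist u s :=
  Nat.sInf_le ⟨s, hs, rfl⟩

theorem exists_gwDist_eq {V : Type*} (G : SimpleGraph V) {S : Finset V} (hS : S.Nonempty) (u : V) :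
    ∃ s ∈ S, gwDist G S u = G.dist u s := by
  obtain ⟨s, hs, h⟩ := Nat.sInf_mem ((Finset.coe_nonempty.2 hS).image fun s => G.dist u s)
  exact ⟨s, hs, h.symm⟩

theorem le_comDist {V : Type*} (G : SimpleGraph V) {S : Finset V} (hS : S.Nonempty) {v w : V}
    {k : ℕ} (hv : k ≤ G.dist v w) (hk : ∀ s ∈ S, k ≤ G.dist s w) : k ≤ comDist G S v w := by
  obtain ⟨s, hs, h⟩ := exists_gwDist_eq G hS w
  have := hk s hs
  rw [SimpleGraph.dist_comm] at this
  exact le_min hv (by omega)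

theorem spider_adj_of_parent {n m : ℕ} {i j : Fin n} (hi : (i : ℕ) ≠ 0)
    (h : (j : ℕ) = spiderParent m i) : (spider n m).Adj i j := by
  rw [spider, SimpleGraph.fromRel_adj]
  refine ⟨fun e => ?_, Or.inl h⟩
  subst e
  unfold spiderParent at h
  split_ifs at h <;> omega

theorem spiderParent_lt {m i : ℕ} (hi : i ≠ 0) : spiderParent m i < i := by
  unfold spiderParent
  split_ifs <;> omega

theorem spiderDepth_parent {m i : ℕ} (hi : i ≠ 0) :
    spiderDepth m (spiderParent m i) + 1 = spiderDepth m i := by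
  unfold spiderDepth spiderParent
  split_ifs <;> omega

theorem spiderDepth_le {m i : ℕ} (hm : 0 < m) : spiderDepth m i ≤ m := by
  unfold spiderDepth
  split_ifs <;> omega

theorem spider_exists_walk_zero {n m : ℕ} (hn : 0 < n) (v : Fin n) :
    ∃ p : (spider n m).Walk v ⟨0, hn⟩, p.length = spiderDepth m v := by
  obtain ⟨v, hv⟩ := v
  induction v using Nat.strong_induction_on with
  | _ v ih =>
    by_cases h : v = 0
    · subst h
      exact ⟨.nil, by simp [spiderDepth]⟩
    · have hlt := spiderParent_lt (m := m) h
      obtain ⟨p, hp⟩ := ih _ hlt (hlt.trans hv)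
      refine ⟨.cons (spider_adj_of_parent h rfl) p, ?_⟩
      rw [SimpleGraph.Walk.length_cons, hp]
      exact spiderDepth_parent h

theorem spider_connected {n m : ℕ} (hn : 0 < n) : (spider n m).Connected := by
  have : Nonempty (Fin n) := ⟨⟨0, hn⟩⟩
  refine ⟨fun u v => ?_⟩
  obtain ⟨p, -⟩ := spider_exists_walk_zero (m := m) hn u
  obtain ⟨q, -⟩ := spider_exists_walk_zero (m := m) hn v
  exact ⟨p.append q.reverse⟩

theorem spider_dist_zero_le {n m : ℕ} (hn : 0 < n) (v : Fin n) :
    (spider n m).dist v ⟨0, hn⟩ ≤ spiderDepth m v := by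
  obtain ⟨p, hp⟩ := spider_exists_walk_zero (m := m) hn v
  exact hp ▸ SimpleGraph.dist_le p

theorem spider_dist_le {n m : ℕ} (hm : 0 < m) (u v : Fin n) :
    (spider n m).dist u v ≤ spiderDepth m u + m := by
  have hn : 0 < n := u.pos
  have h := (spider_connected (m := m) hn).dist_triangle (u := u) (v := ⟨0, hn⟩) (w := v)
  have hu := spider_dist_zero_le (m := m) hn u
  have hv := spider_dist_zero_le (m := m) hn v
  rw [SimpleGraph.dist_comm] at hv
  have := spiderDepth_le (i := v) hm
  omega

theorem abs_spiderHeight_parent_sub_le (m r i : ℕ) :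
    |spiderHeight m r (spiderParent m i) - spiderHeight m r i| ≤ 1 := by
  rw [abs_le]
  unfold spiderHeight spiderDepth spiderParent
  split_ifs <;> omega

theorem spiderHeight_sub_le_dist {n m : ℕ} (r : ℕ) (u v : Fin n) :
    spiderHeight m r v - spiderHeight m r u ≤ (spider n m).dist u v := by
  refine (spider_connected u.pos).sub_le_dist (fun i : Fin n => spiderHeight m r i)
    (fun x y h => ?_) u v
  rw [spider, SimpleGraph.fromRel_adj] at h
  rcases h.2 with h | h
  · have := abs_le.1 (abs_spiderHeight_parent_sub_le m r x)
    rw [h]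
    exact this.2
  · have := abs_le.1 (abs_spiderHeight_parent_sub_le m r y)
    rw [h]
    linarith [this.1]

/-- Every vertex is as far as possible from a leaf that the leaf `3 * m` is at least as far from. -/
theorem spider_exists_far {n m : ℕ} (hm : 0 < m) (hmn : 3 * m < n) (v : Fin n) :
    ∃ w : Fin n, spiderDepth m v + m ≤ (spider n m).dist v w ∧
      2 * m ≤ (spider n m).dist ⟨3 * m, hmn⟩ w := by
  by_cases hv : (v : ℕ) % 3 = 1
  · refine ⟨⟨3 * m - 1, by omega⟩, ?_, ?_⟩ <;> zify
    · refine le_trans ?_ (spiderHeight_sub_le_dist 2 _ _)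
      simp only [spiderHeight, spiderDepth]
      split_ifs <;> omega
    · refine le_trans ?_ (spiderHeight_sub_le_dist 2 _ _)
      simp only [spiderHeight, spiderDepth]
      split_ifs <;> omega
  · refine ⟨⟨3 * m - 2, by omega⟩, ?_, ?_⟩ <;> zify
    · refine le_trans ?_ (spiderHeight_sub_le_dist 1 _ _)
      simp only [spiderHeight, spiderDepth]
      split_ifs <;> omega
    · refine le_trans ?_ (spiderHeight_sub_le_dist 1 _ _)
      simp only [spiderHeight, spiderDepth]
      split_ifs <;> omega

theorem comDist_le_sup {V : Type*} [Fintype V] (G : SimpleGraph V) (S : Finset V) (v w : V) :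
    comDist G S v w ≤ Finset.univ.sup (fun u => comDist G S v u) :=
  Finset.le_sup (f := fun u => comDist G S v u) (Finset.mem_univ w)

theorem spider_maxNash {n m : ℕ} {α : ℝ} (hα : 0 ≤ α) (hm : 0 < m) (hmn : 3 * m < n) :
    MaxNash (spider n m) α {⟨3 * m, hmn⟩} := by
  rintro S' ⟨v, ⟨hv, rfl⟩ | ⟨hv, rfl, hne⟩, hlt⟩
  · obtain ⟨w, hvw, hsw⟩ := spider_exists_far hm hmn v
    have hd := spiderDepth_le (i := v) hm
    have hge : spiderDepth m v + m ≤
        comDist (spider n m) (insert v {⟨3 * m, hmn⟩}) v w := by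
      refine le_comDist _ (Finset.insert_nonempty _ _) hvw fun s hs => ?_
      rcases Finset.mem_insert.1 hs with rfl | hs
      · exact hvw
      · rw [Finset.mem_singleton.1 hs]
        omega
    have hge' := hge.trans (comDist_le_sup _ _ _ _)
    have hle : Finset.univ.sup (fun u => comDist (spider n m) {⟨3 * m, hmn⟩} v u) ≤
        spiderDepth m v + m :=
      Finset.sup_le fun u _ => (min_le_left _ _).trans (spider_dist_le hm v u)
    have hcast : ((Finset.univ.sup (fun u => comDist (spider n m) {⟨3 * m, hmn⟩} v u) : ℕ) : ℝ) ≤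
        ((Finset.univ.sup
          (fun u => comDist (spider n m) (insert v {⟨3 * m, hmn⟩}) v u) : ℕ) : ℝ) := by
      exact_mod_cast hle.trans hge'
    rw [maxCost, maxCost, if_neg hv, if_pos (Finset.mem_insert_self _ _)] at hlt
    linarith
  · rw [Finset.mem_singleton.1 hv] at hne
    simp at hne

theorem le_maxSocial_spider {n m : ℕ} {α : ℝ} (hα : 0 ≤ α) (hm : 0 < m) (hmn : 3 * m < n) :
    (n : ℝ) * m ≤ maxSocial (spider n m) α {⟨3 * m, hmn⟩} := by
  have h : ∀ v ∈ (Finset.univ : Finset (Fin n)),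
      (m : ℝ) ≤ maxCost (spider n m) α {⟨3 * m, hmn⟩} v := by
    intro v _
    obtain ⟨w, hvw, hsw⟩ := spider_exists_far hm hmn v
    have hge : m ≤ comDist (spider n m) {⟨3 * m, hmn⟩} v w := by
      refine le_comDist _ (Finset.singleton_nonempty _) (by omega) fun s hs => ?_
      rw [Finset.mem_singleton.1 hs]
      omega
    have hge' : (m : ℝ) ≤ ((Finset.univ.sup
        (fun u => comDist (spider n m) {⟨3 * m, hmn⟩} v u) : ℕ) : ℝ) := by
      exact_mod_cast hge.trans (comDist_le_sup _ _ _ _)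
    unfold maxCost
    split_ifs <;> linarith
  simpa [maxSocial] using Finset.card_nsmul_le_sum _ _ _ h

/-- A set of gateways containing one vertex in `t` consecutive ones along each leg. -/
def spiderGateways (n t : ℕ) : Finset (Fin n) :=
  Finset.univ.filter fun i => (i : ℕ) % (3 * t) < 3

theorem gwDist_spiderGateways_le {n m t : ℕ} (ht : 0 < t) (v : Fin n) :
    gwDist (spider n m) (spiderGateways n t) v ≤ t := by
  have hn : 0 < n := v.pos
  have hz : (⟨0, hn⟩ : Fin n) ∈ spiderGateways n t := by simp [spiderGateways]
  by_cases hv : (v : ℕ) ≤ 3 * m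
  · have key : ∀ i, ∀ hi : i < n, i ≤ 3 * m → ∃ s ∈ spiderGateways n t,
        (spider n m).dist ⟨i, hi⟩ s ≤ i % (3 * t) / 3 := by
      intro i
      induction i using Nat.strong_induction_on with
      | _ i ih =>
        intro hi him
        by_cases h : i % (3 * t) < 3
        · exact ⟨⟨i, hi⟩, by simp [spiderGateways, h], by simp⟩
        · have hle := Nat.mod_le i (3 * t)
          obtain ⟨s, hs, hd⟩ := ih (i - 3) (by omega) (by omega) (by omega)
          have hmod : (i - 3) % (3 * t) = i % (3 * t) - 3 := by
            have hlt := Nat.mod_lt i (show 0 < 3 * t by omega)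
            have hdm := Nat.div_add_mod i (3 * t)
            have : i - 3 = (i % (3 * t) - 3) + 3 * t * (i / (3 * t)) := by omega
            rw [this, Nat.add_mul_mod_self_left, Nat.mod_eq_of_lt (by omega)]
          rw [hmod] at hd
          have hadj : (spider n m).Adj ⟨i, hi⟩ ⟨i - 3, by omega⟩ :=
            spider_adj_of_parent (by simp only; omega) (by simp [spiderParent, him])
          have h1 := SimpleGraph.dist_eq_one_iff_adj.2 hadj
          have htri := (spider_connected (m := m) hn).dist_triangle
            (u := ⟨i, hi⟩) (v := ⟨i - 3, by omega⟩) (w := s)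
          exact ⟨s, hs, by omega⟩
    obtain ⟨s, hs, hd⟩ := key v v.2 hv
    have hlt := Nat.mod_lt (v : ℕ) (show 0 < 3 * t by omega)
    exact (gwDist_le _ v hs).trans (hd.trans (by omega))
  · refine (gwDist_le _ v hz).trans ((spider_dist_zero_le hn v).trans ?_)
    simp only [spiderDepth, hv, if_false]
    exact ht

theorem card_spiderGateways_le (n t : ℕ) :
    (spiderGateways n t).card ≤ (n / (3 * t) + 1) * 3 := by
  have h : (spiderGateways n t).card ≤
      (Finset.range (n / (3 * t) + 1) ×ˢ Finset.range 3).card := by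
    refine Finset.card_le_card_of_injOn (fun i => ((i : ℕ) / (3 * t), (i : ℕ) % (3 * t))) ?_ ?_
    · intro i hi
      have hi' : (i : ℕ) % (3 * t) < 3 := by simpa [spiderGateways] using hi
      have := Nat.div_le_div_right (c := 3 * t) i.2.le
      simp only [Finset.coe_product, Set.mem_prod, Finset.mem_coe, Finset.mem_range]
      exact ⟨by omega, hi'⟩
    · intro i _ j _ hij
      simp only [Prod.mk.injEq] at hij
      ext
      rw [← Nat.div_add_mod (i : ℕ) (3 * t), hij.1, hij.2, Nat.div_add_mod]
  simpa using h

theorem maxSocial_spiderGateways_le {n m t : ℕ} {α : ℝ} (hα : 0 ≤ α) (ht : 0 < t) :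
    maxSocial (spider n m) α (spiderGateways n t) ≤ α * (n / t + 3) + n * (2 * t) := by
  have hcost : ∀ v, maxCost (spider n m) α (spiderGateways n t) v ≤
      (if v ∈ spiderGateways n t then α else 0) + 2 * t := by
    intro v
    have hle : Finset.univ.sup (fun u => comDist (spider n m) (spiderGateways n t) v u) ≤
        2 * t := by
      refine Finset.sup_le fun u _ => (min_le_right _ _).trans ?_
      have hu := gwDist_spiderGateways_le (m := m) ht u
      have hv := gwDist_spiderGateways_le (m := m) ht v
      omega
    unfold maxCost
    gcongr
    exact_mod_cast hle
  have hcard : ((spiderGateways n t).card : ℝ) ≤ n / t + 3 := by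
    have h1 : ((spiderGateways n t).card : ℝ) ≤ (((n / (3 * t) : ℕ) : ℝ) + 1) * 3 := by
      exact_mod_cast card_spiderGateways_le n t
    have h2 : ((n / (3 * t) : ℕ) : ℝ) ≤ (n : ℝ) / ((3 * t : ℕ) : ℝ) := Nat.cast_div_le
    have h3 : (n : ℝ) / ((3 * t : ℕ) : ℝ) * 3 = n / t := by
      have : (t : ℝ) ≠ 0 := by positivity
      push_cast
      field_simp
    linarith
  calc maxSocial (spider n m) α (spiderGateways n t)
      ≤ ∑ v : Fin n, ((if v ∈ spiderGateways n t then α else 0) + 2 * (t : ℝ)) :=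
        Finset.sum_le_sum fun v _ => hcost v
    _ = α * (spiderGateways n t).card + n * (2 * t) := by
        simp [Finset.sum_add_distrib, mul_comm]
    _ ≤ α * (n / t + 3) + n * (2 * t) := by gcongr

/-- There is a constant C > 0 such that for every α ≥ 1 and every n ≥ C·√α there are a
connected graph on n vertices, a Nash equilibrium S of the MAX-game, and a nonempty
profile S* with c(S) ≥ (n/(C·√α))·c(S*): the price of anarchy of the MAX-game is
Ω(1 + n/√α) for α ≥ 1. -/
theorem stmt_19 :
    ∃ C : ℝ, 0 < C ∧
      ∀ α : ℝ, 1 ≤ α → ∀ n : ℕ, C * Real.sqrt α ≤ (n : ℝ) →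
        ∃ (G : SimpleGraph (Fin n)) (S Sstar : Finset (Fin n)),
          G.Connected ∧ S.Nonempty ∧ Sstar.Nonempty ∧ MaxNash G α S ∧
          ((n : ℝ) / (C * Real.sqrt α)) * maxSocial G α Sstar ≤ maxSocial G α S := by
  refine ⟨36, by norm_num, fun α hα n hn => ?_⟩
  have hr : 1 ≤ √α := Real.one_le_sqrt.2 hα
  have hsq : √α * √α = α := Real.mul_self_sqrt (by linarith)
  have hn36 : 36 ≤ n := by
    have : (36 : ℝ) ≤ n := by linarith
    exact_mod_cast this
  obtain ⟨m, hm⟩ : ∃ m, m = (n - 1) / 3 := ⟨_, rfl⟩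
  obtain ⟨t, ht⟩ : ∃ t, t = ⌈√α⌉₊ := ⟨_, rfl⟩
  have hm0 : 0 < m := by omega
  have hmn : 3 * m < n := by omega
  have hrt : √α ≤ t := ht ▸ Nat.le_ceil _
  have htr : (t : ℝ) ≤ 2 * √α := by
    have := Nat.ceil_lt_add_one (show 0 ≤ √α by linarith)
    rw [ht]
    linarith
  have ht0 : 0 < t := by
    have : (0 : ℝ) < t := by linarith
    exact_mod_cast this
  have hα0 : 0 ≤ α := by linarith
  refine ⟨spider n m, {⟨3 * m, hmn⟩}, spiderGateways n t, spider_connected (by omega),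
    Finset.singleton_nonempty _, ⟨⟨0, by omega⟩, by simp [spiderGateways]⟩,
    spider_maxNash hα0 hm0 hmn, ?_⟩
  refine le_trans ?_ (le_maxSocial_spider hα0 hm0 hmn)
  have hopt : maxSocial (spider n m) α (spiderGateways n t) ≤ 6 * n * √α := by
    refine (maxSocial_spiderGateways_le hα0 ht0).trans ?_
    have h1 : α * (n / t) ≤ n * √α := by
      have ht' : (0 : ℝ) < t := by exact_mod_cast ht0
      rw [← mul_div_assoc, div_le_iff₀ ht']
      calc α * n = n * √α * √α := by rw [mul_assoc, hsq, mul_comm]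
        _ ≤ n * √α * t := by gcongr
    have h2 : α * 3 ≤ n * √α := by
      calc α * 3 = 3 * √α * √α := by rw [mul_assoc, hsq, mul_comm]
        _ ≤ n * √α := by
          gcongr
          linarith
    have h3 : (n : ℝ) * (2 * t) ≤ n * (2 * (2 * √α)) := by gcongr
    linarith
  have hm6 : (n : ℝ) ≤ 6 * m := by
    have : n ≤ 6 * m := by omega
    exact_mod_cast this
  calc (n : ℝ) / (36 * √α) * maxSocial (spider n m) α (spiderGateways n t)
      ≤ (n : ℝ) / (36 * √α) * (6 * n * √α) := by gcongr
    _ = n * (n / 6) := by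
        have : √α ≠ 0 := by positivity
        field_simp
        norm_num
    _ ≤ n * m := by
        gcongr
        linarith
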